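/- arXiv:1309.1899 — 2 statements merged into one kernel-verified Lean document; each statement's English description precedes it below -/
import Mathlib

section
/- A general cubic fourfold apolar to a Veronese surface has no net of partial derivatives singular at a given point. Precisely: there exists a nonzero polynomial function P on the 28-dimensional space of sextic forms in 3 variables such that for every sextic g with P(g) ≠ 0 and f = s(g), there is no v ∈ ℂ⁶ ∖ {0} and no 3-dimensional linear subspace W ⊆ ℂ⁶ with ∂_v(∂_w f) = 0 for all w ∈ W. (Corollary 2.5 of the paper.) -/
open MvPolynomial

/-- The constant-coefficient differential operator associated with the monomial
exponent `d`: the composition over `i` of `(∂/∂xᵢ)^(d i)`. -/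
noncomputable def monOp {n : ℕ} (d : Fin n →₀ ℕ) :
    Module.End ℂ (MvPolynomial (Fin n) ℂ) :=
  (List.ofFn fun i : Fin n =>
    ((pderiv (R := ℂ) i).toLinearMap : Module.End ℂ (MvPolynomial (Fin n) ℂ)) ^ (d i)).prod

/-- The apolarity action `g ∘ f` : apply `g`, viewed as a constant-coefficient
differential operator, to `f`. -/
noncomputable def apolar {n : ℕ} (g f : MvPolynomial (Fin n) ℂ) :
    MvPolynomial (Fin n) ℂ :=
  ∑ d ∈ g.support, coeff d g • monOp d f

/-- The apolarity pairing `⟨f, k⟩ := k ∘ f` (its constant term). -/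
noncomputable def pairing {n : ℕ} (f k : MvPolynomial (Fin n) ℂ) : ℂ :=
  eval (fun _ => (0 : ℂ)) (apolar k f)

/-- The linear form `Σ vᵢ xᵢ` associated with a vector `v`. -/
noncomputable def linForm {n : ℕ} (v : Fin n → ℂ) : MvPolynomial (Fin n) ℂ :=
  ∑ i, MvPolynomial.C (v i) * X i

/-- The directional partial derivative `∂_v f = Σ vᵢ ∂f/∂xᵢ`. -/
noncomputable def pdir {n : ℕ} (v : Fin n → ℂ) (f : MvPolynomial (Fin n) ℂ) :
    MvPolynomial (Fin n) ℂ :=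
  ∑ i, MvPolynomial.C (v i) * pderiv i f

/-- The Veronese map `ν : ℂ³ → ℂ⁶`. -/
noncomputable def nu (w : Fin 3 → ℂ) : Fin 6 → ℂ :=
  ![w 0 ^ 2, 2 * w 0 * w 1, 2 * w 0 * w 2, w 1 ^ 2, 2 * w 1 * w 2, w 2 ^ 2]

/-- The components of the Veronese map as quadratic forms in `y₀, y₁, y₂`. -/
noncomputable def nuPoly : Fin 6 → MvPolynomial (Fin 3) ℂ :=
  ![X 0 ^ 2, 2 * X 0 * X 1, 2 * X 0 * X 2, X 1 ^ 2, 2 * X 1 * X 2, X 2 ^ 2]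

/-- A quadratic form `q` in 6 variables has rank `≤ r`: there is a symmetric matrix
`M` of rank `≤ r` with `q(x) = xᵀ M x`. -/
def QuadRankLe (q : MvPolynomial (Fin 6) ℂ) (r : ℕ) : Prop :=
  ∃ M : Matrix (Fin 6) (Fin 6) ℂ, M.IsSymm ∧ M.rank ≤ r ∧
    ∀ x : Fin 6 → ℂ, eval x q = ∑ i, ∑ j, M i j * x i * x j

/-- `s` is the linear map carrying a ternary sextic `g` to the cubic `s(g)` in six
variables, characterized by `⟨s(g), k⟩ = ⟨g, m(k)⟩` for all cubic forms `k`, where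
`m(k) = k ∘ ν`. -/
def IsSMap (s : MvPolynomial (Fin 3) ℂ →ₗ[ℂ] MvPolynomial (Fin 6) ℂ) : Prop :=
  (∀ g : MvPolynomial (Fin 3) ℂ, g.IsHomogeneous 6 → (s g).IsHomogeneous 3) ∧
  ∀ g : MvPolynomial (Fin 3) ℂ, ∀ k : MvPolynomial (Fin 6) ℂ,
    g.IsHomogeneous 6 → k.IsHomogeneous 3 →
      pairing (s g) k = pairing g (aeval nuPoly k)

/-- Evaluation of a polynomial function `P` in the coefficients at a polynomial `g`. -/
noncomputable def evalCoeff {σ : Type} (g : MvPolynomial σ ℂ) (P : MvPolynomial (σ →₀ ℕ) ℂ) : ℂ :=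
  eval (fun d => coeff d g) P

/-- The vanishing ideal of a subset of `ℂ⁵⁶`. -/
noncomputable def vanishingIdealOf (S : Set (Fin 56 → ℂ)) : Ideal (MvPolynomial (Fin 56) ℂ) :=
  ⨅ x ∈ S, RingHom.ker (eval x)

/-- An ideal is a prime ideal of height one: it is prime, admits a prime strictly
below it, and admits no chain of two primes strictly below it. -/
def IsHeightOnePrime {R : Type*} [CommRing R] (I : Ideal R) : Prop :=
  I.IsPrime ∧ (∃ p : Ideal R, p.IsPrime ∧ p < I) ∧
    ∀ p q : Ideal R, p.IsPrime → q.IsPrime → p < q → ¬ q < I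

/-- The space `Q_{f,U}` of quadratic forms vanishing on `U` and apolar to `f`. -/
def QfU (f : MvPolynomial (Fin 6) ℂ) (U : Submodule ℂ (Fin 6 → ℂ)) :
    Set (MvPolynomial (Fin 6) ℂ) :=
  {q | q.IsHomogeneous 2 ∧ (∀ u ∈ U, eval u q = 0) ∧ apolar q f = 0}

/-- The Zariski closure of a subset of `ℂ⁵⁶`. -/
def zcl (S : Set (Fin 56 → ℂ)) : Set (Fin 56 → ℂ) :=
  {x | ∀ P : MvPolynomial (Fin 56) ℂ, (∀ y ∈ S, eval y P = 0) → eval x P = 0}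

/-- The projection of a polynomial onto its squarefree monomials. -/
noncomputable def sqfreeProj (f : MvPolynomial (Fin 6) ℂ) : MvPolynomial (Fin 6) ℂ :=
  ∑ d ∈ f.support.filter (fun d => ∀ i, d i ≤ 1), monomial d (coeff d f)

section Elimination
attribute [local instance] MvPolynomial.gradedAlgebra

theorem homogeneousComponent_mul_of_isHomogeneous {σ R : Type*} [CommSemiring R]
    (h : MvPolynomial σ R) {F : MvPolynomial σ R} {e : ℕ} (hF : F.IsHomogeneous e) (k : ℕ) :
    homogeneousComponent (k + e) (h * F) = homogeneousComponent k h * F := by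
  have := DirectSum.coe_decompose_mul_add_of_right_mem (homogeneousSubmodule σ R) (i := k)
    (a := h) ((mem_homogeneousSubmodule e F).2 hF)
  rwa [← decomposition.decompose'_apply, ← decomposition.decompose'_apply]

end Elimination

theorem eval_eq_sum_finsuppAntidiag {n R : Type*} [Fintype n] [DecidableEq n] [CommSemiring R]
    {G : MvPolynomial n R} {D : ℕ} (hG : G.IsHomogeneous D) (v : n → R) :
    eval v G = ∑ m : Finset.finsuppAntidiag (Finset.univ : Finset n) D,
      coeff m.1 G * ∏ i, v i ^ m.1 i := by
  rw [Finset.sum_coe_sort (Finset.finsuppAntidiag Finset.univ D)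
    (fun m => coeff m G * ∏ i, v i ^ m i), eval_eq']
  refine Finset.sum_subset (fun m hm => ?_) (fun m _ hm => ?_)
  · have := hG (mem_support_iff.1 hm)
    change Finsupp.weight (fun _ => 1) m = D at this
    rw [← Finsupp.degree_eq_weight_one, Finsupp.degree_eq_sum] at this
    simpa using this
  · rw [notMem_support_iff.1 hm, zero_mul]

/-- If a family of homogeneous polynomials with polynomial coefficients has no nontrivial common
zero at one parameter `x₀`, then it has none on a principal open set of parameters around `x₀`. -/
theorem exists_eval_ne_zero_forall_common_zero_eq_zero {K σ n ι : Type*} [Field K] [IsAlgClosed K]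
    [Fintype n] [Finite ι] {e : ℕ} (F : ι → MvPolynomial n (MvPolynomial σ K))
    (hF : ∀ i, (F i).IsHomogeneous e) (x₀ : σ → K)
    (h₀ : ∀ v : n → K, (∀ i, eval v (map (eval x₀) (F i)) = 0) → v = 0) :
    ∃ P : MvPolynomial σ K, eval x₀ P ≠ 0 ∧ ∀ x, eval x P ≠ 0 →
      ∀ v : n → K, (∀ i, eval v (map (eval x) (F i)) = 0) → v = 0 := by
  classical
  have := Fintype.ofFinite ι
  set I : Ideal (MvPolynomial n K) := Ideal.span (Set.range fun i => map (eval x₀) (F i)) with hI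
  have hrad : idealOfVars n K ≤ I.radical := by
    rw [← vanishingIdeal_zeroLocus_eq_radical (K := K), hI, zeroLocus_span, Ideal.span_le]
    rintro _ ⟨j, rfl⟩ v hv
    have : v = 0 := h₀ v fun i => by
      simpa [aeval_eq_eval] using hv _ ⟨i, rfl⟩
    simp [this]
  obtain ⟨N, hN⟩ := Ideal.exists_pow_le_of_le_radical_of_fg hrad (idealOfVars_fg n K)
  let S := Finset.finsuppAntidiag (Finset.univ : Finset n) (N + e)
  have hdeg (m : S) : m.1.degree = N + e := by
    have := (Finset.mem_finsuppAntidiag.1 m.2).1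
    rwa [Finsupp.degree_eq_sum]
  have hmem (m : S) : ∃ h : ι → MvPolynomial n K, (∀ i, (h i).IsHomogeneous N) ∧
      ∑ i, h i * map (eval x₀) (F i) = monomial m.1 1 := by
    have h1 : monomial m.1 (1 : K) ∈ I :=
      hN ((monomial_mem_pow_idealOfVars_iff N m.1 one_ne_zero).2 (by rw [hdeg]; omega))
    obtain ⟨h, hh⟩ := Ideal.mem_span_range_iff_exists_fun.1 h1
    refine ⟨fun i => homogeneousComponent N (h i), fun i => homogeneousComponent_isHomogeneous _ _,
      ?_⟩
    rw [← homogeneousComponent_eq_self (isHomogeneous_monomial (1 : K) (hdeg m)), ← hh, map_sum]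
    exact Finset.sum_congr rfl fun i _ =>
      (homogeneousComponent_mul_of_isHomogeneous _ ((hF i).map _) N).symm
  choose h hh hsum using hmem
  let G (m : S) : MvPolynomial n (MvPolynomial σ K) := ∑ i, map C (h m i) * F i
  have hG (m : S) : (G m).IsHomogeneous (N + e) :=
    IsHomogeneous.sum _ _ _ fun i _ => ((hh m i).map _).mul (hF i)
  have hGx (x : σ → K) (m : S) :
      map (eval x) (G m) = ∑ i, h m i * map (eval x) (F i) := by
    have : (eval x).comp (C : K →+* MvPolynomial σ K) = RingHom.id K := by ext; simp
    simp [G, map_map, this, map_id]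
  let A : Matrix S S (MvPolynomial σ K) := Matrix.of fun m m' => coeff m'.1 (G m)
  have hA (x : σ → K) : eval x A.det = (Matrix.of fun m m' : S =>
      coeff m'.1 (map (eval x) (G m))).det := by
    rw [RingHom.map_det]
    congr 1
  refine ⟨A.det, ?_, fun x hx v hv => ?_⟩
  · have : (Matrix.of fun m m' : S => coeff m'.1 (map (eval x₀) (G m))) = 1 := by
      ext m m'
      simp only [Matrix.of_apply, hGx, hsum, coeff_monomial, Matrix.one_apply, Subtype.ext_iff]
    rw [hA, this, Matrix.det_one]
    exact one_ne_zero
  · rw [hA] at hx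
    have hker : (Matrix.of fun m m' : S => coeff m'.1 (map (eval x) (G m))).mulVec
        (fun m' => ∏ i, v i ^ m'.1 i) = 0 := by
      ext m
      have h1 := eval_eq_sum_finsuppAntidiag ((hG m).map (eval x)) v
      rw [hGx] at h1
      simp only [map_sum, map_mul, hv, mul_zero, Finset.sum_const_zero] at h1
      simpa [Matrix.mulVec, dotProduct, hGx] using h1.symm
    have hz := Matrix.eq_zero_of_mulVec_eq_zero hx hker
    ext j
    have h2 := congrFun hz ⟨Finsupp.single j (N + e),
      Finset.mem_finsuppAntidiag.2 ⟨by simp only [Finsupp.single_apply, Finset.sum_ite_eq,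
        Finset.mem_univ, if_true], Finset.subset_univ _⟩⟩
    have h3 : v j ^ (N + e) = 0 := by
      simpa only [Finsupp.single_apply, pow_ite, pow_zero, Finset.prod_ite_eq, Finset.mem_univ,
        if_true, Pi.zero_apply] using h2
    exact eq_zero_of_pow_eq_zero h3

theorem det_fin_four {R : Type*} [CommRing R] (A : Matrix (Fin 4) (Fin 4) R) :
    A.det =
      A 0 0 * (A 1 1 * (A 2 2 * A 3 3 - A 2 3 * A 3 2) - A 1 2 * (A 2 1 * A 3 3 - A 2 3 * A 3 1)
        + A 1 3 * (A 2 1 * A 3 2 - A 2 2 * A 3 1))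
      - A 0 1 * (A 1 0 * (A 2 2 * A 3 3 - A 2 3 * A 3 2) - A 1 2 * (A 2 0 * A 3 3 - A 2 3 * A 3 0)
        + A 1 3 * (A 2 0 * A 3 2 - A 2 2 * A 3 0))
      + A 0 2 * (A 1 0 * (A 2 1 * A 3 3 - A 2 3 * A 3 1) - A 1 1 * (A 2 0 * A 3 3 - A 2 3 * A 3 0)
        + A 1 3 * (A 2 0 * A 3 1 - A 2 1 * A 3 0))
      - A 0 3 * (A 1 0 * (A 2 1 * A 3 2 - A 2 2 * A 3 1) - A 1 1 * (A 2 0 * A 3 2 - A 2 2 * A 3 0)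
        + A 1 2 * (A 2 0 * A 3 1 - A 2 1 * A 3 0)) := by
  rw [Matrix.det_succ_row_zero]
  simp only [Fin.sum_univ_four, Matrix.det_fin_three, Matrix.submatrix_apply]
  simp [Fin.succAbove, Fin.lt_def]
  ring

/-- The catalecticant matrix of the quartic obtained by letting the conic
`a x² + b y² + c z² + d yz + e xz + f xy` act by contraction on the divided power sextic
`x⁶ + y⁶ + z⁶ + x² y² z²`; rows and columns are indexed by `x², xy, xz, y², yz, z²`. -/
def fermatCat (a b c d e f : ℂ) : Matrix (Fin 6) (Fin 6) ℂ :=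
  !![a, 0, 0, c, d, b;
     0, c, d, 0, e, f;
     0, d, b, e, f, 0;
     c, 0, e, b, 0, a;
     d, e, f, 0, a, 0;
     b, f, 0, a, 0, c]

/-- All `4 × 4` minors of `M` vanish. -/
def MinorsVanish (M : Matrix (Fin 6) (Fin 6) ℂ) : Prop :=
  ∀ r c : Fin 4 → Fin 6, (M.submatrix r c).det = 0

namespace MinorsVanish

theorem swap {a b c d e f : ℂ} (h : MinorsVanish (fermatCat a b c d e f)) :
    MinorsVanish (fermatCat b a c e d f) := by
  have : fermatCat b a c e d f =
      (fermatCat a b c d e f).submatrix ![3, 1, 4, 0, 2, 5] ![3, 1, 4, 0, 2, 5] := by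
    ext i j
    fin_cases i <;> fin_cases j <;> simp [fermatCat]
  intro r s
  rw [this, Matrix.submatrix_submatrix]
  exact h _ _

theorem rotate {a b c d e f : ℂ} (h : MinorsVanish (fermatCat a b c d e f)) :
    MinorsVanish (fermatCat b c a e f d) := by
  have : fermatCat b c a e f d =
      (fermatCat a b c d e f).submatrix ![3, 4, 1, 5, 2, 0] ![3, 4, 1, 5, 2, 0] := by
    ext i j
    fin_cases i <;> fin_cases j <;> simp [fermatCat]
  intro r s
  rw [this, Matrix.submatrix_submatrix]
  exact h _ _

variable {a b c d e f : ℂ}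

theorem relation_same (h : MinorsVanish (fermatCat a b c d e f)) :
    a ^ 2 * e * f + c * d * f ^ 2 + b * d * e ^ 2 = d ^ 2 * e * f := by
  have := h ![0, 3, 5, 4] ![4, 2, 1, 0]
  rw [det_fin_four] at this
  simp [fermatCat] at this
  linear_combination -this

theorem relation_next (h : MinorsVanish (fermatCat a b c d e f)) :
    a * c * e * f + b * d * f ^ 2 + a * d * e ^ 2 = 0 := by
  have := h ![0, 3, 5, 4] ![4, 2, 1, 3]
  rw [det_fin_four] at this
  simp [fermatCat] at this
  linear_combination -this

theorem mul_sq_eq (h : MinorsVanish (fermatCat a b c d e f)) (he : e ≠ 0) :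
    a * d ^ 2 = c * f ^ 2 := by
  have h1 := h.relation_next
  have h2 := h.rotate.swap.relation_next
  have : e ^ 2 * (a * d ^ 2 - c * f ^ 2) = 0 := by
    linear_combination d * h1 - f * h2
  simpa [he, sub_eq_zero] using this

theorem pow_six_mul (h : MinorsVanish (fermatCat a b c d e f)) (hd : d ≠ 0) (he : e ≠ 0)
    (hf : f ≠ 0) (ha : a ≠ 0) : e ^ 6 * (a * d ^ 2 + d * e * f) = -(d * e * f) ^ 3 := by
  have h1 := h.relation_next
  have hc : c * f ^ 2 = a * d ^ 2 := (h.mul_sq_eq he).symm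
  have hb : b * e ^ 2 = a * d ^ 2 := (h.swap.rotate.mul_sq_eq hf).symm
  have : a * d ^ 2 * f * (e ^ 6 * (a * d ^ 2 + d * e * f) + (d * e * f) ^ 3) = 0 := by
    linear_combination d ^ 2 * f ^ 2 * e ^ 5 * h1 - a * d ^ 2 * e ^ 6 * f * hc
      - d ^ 3 * e ^ 3 * f ^ 4 * hb
  have := (mul_eq_zero.1 this).resolve_left (by simp [ha, hd, hf])
  linear_combination this

theorem exists_eq_zero (h : MinorsVanish (fermatCat a b c d e f)) : d * e * f = 0 := by
  by_contra hp
  have hd : d ≠ 0 := by rintro rfl; simp at hp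
  have he : e ≠ 0 := by rintro rfl; simp at hp
  have hf : f ≠ 0 := by rintro rfl; simp at hp
  have hc : c * f ^ 2 = a * d ^ 2 := (h.mul_sq_eq he).symm
  have hb : b * e ^ 2 = a * d ^ 2 := (h.swap.rotate.mul_sq_eq hf).symm
  have hsame := h.relation_same
  have ha : a ≠ 0 := by
    rintro rfl
    have hc0 : c = 0 := by simpa [hf] using hc
    have hb0 : b = 0 := by simpa [he] using hb
    subst hc0 hb0
    simp [hd, he, hf] at hsame
  have hb1 : b ≠ 0 := by
    rintro rfl
    simp [ha, hd] at hb
  have hc1 : c ≠ 0 := by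
    rintro rfl
    simp [ha, hd] at hc
  have h1 := h.pow_six_mul hd he hf ha
  have h2 := h.rotate.pow_six_mul he hf hd hb1
  have h3 := h.rotate.rotate.pow_six_mul hf hd he hc1
  rw [hb] at h2
  rw [hc] at h3
  obtain ⟨s, hs⟩ : ∃ s, s = a * d ^ 2 := ⟨_, rfl⟩
  obtain ⟨p, hpdef⟩ : ∃ p, p = d * e * f := ⟨_, rfl⟩
  rw [show e * f * d = d * e * f by ring] at h2
  rw [show f * d * e = d * e * f by ring] at h3
  rw [← hpdef, ← hs] at h1 h2 h3
  rw [← hpdef] at hp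
  have hcube : (s + p) ^ 3 = -p ^ 3 := by
    have : p ^ 6 * ((s + p) ^ 3 + p ^ 3) = 0 := by
      have : (e ^ 6 * (s + p)) * (f ^ 6 * (s + p)) * (d ^ 6 * (s + p)) = (-p ^ 3) ^ 3 := by
        rw [h1, h2, h3]; ring
      rw [mul_add, hpdef] at *
      linear_combination this
    have := (mul_eq_zero.1 this).resolve_left (pow_ne_zero _ hp)
    linear_combination this
  have hmix : s ^ 3 + s ^ 2 * p - 2 * s * p ^ 2 + p ^ 3 = 0 := by
    have h4 : s ^ 2 * p = d ^ 6 * (p - 2 * s) := by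
      rw [hs, hpdef]
      linear_combination d ^ 5 * hsame - d ^ 6 * hc - d ^ 6 * hb
    have : p * (s ^ 3 + s ^ 2 * p - 2 * s * p ^ 2 + p ^ 3) = 0 := by
      linear_combination (s + p) * h4 + (p - 2 * s) * h3
    exact (mul_eq_zero.1 this).resolve_left hp
  have hfac : (s + 2 * p) * (s ^ 2 + s * p + p ^ 2) = 0 := by linear_combination hcube
  rcases mul_eq_zero.1 hfac with h4 | h4
  · have hp3 : p ^ 3 = 0 := by
      linear_combination hmix - (s ^ 2 - s * p) * h4
    exact hp (eq_zero_of_pow_eq_zero hp3)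
  · have h5 : p ^ 2 * (p - 3 * s) = 0 := by
      linear_combination hmix - s * h4
    have h6 : p = 3 * s := sub_eq_zero.1 ((mul_eq_zero.1 h5).resolve_left (pow_ne_zero _ hp))
    have h7 : s ^ 2 = 0 := by
      rw [h6] at h4
      linear_combination h4 / 13
    exact hp (by rw [h6, eq_zero_of_pow_eq_zero h7, mul_zero])

theorem eq_zero_of_eq_zero (h : MinorsVanish (fermatCat a b c d e 0)) : d * e = 0 := by
  by_contra hp
  have hd : d ≠ 0 := by rintro rfl; simp at hp
  have he : e ≠ 0 := by rintro rfl; simp at hp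
  have ha : a = 0 := by simpa [hd, he] using h.relation_next
  have hb : b = 0 := by simpa [hd, he] using h.relation_same
  subst ha hb
  have := h ![0, 3, 4, 2] ![4, 2, 0, 3]
  rw [det_fin_four] at this
  simp [fermatCat, hd, he] at this

theorem middle_eq_zero (h : MinorsVanish (fermatCat a b c d 0 0)) : d = 0 := by
  by_contra hd
  have h1 := h ![0, 2, 3, 5] ![4, 1, 0, 3]
  have h2 := h ![0, 2, 3, 5] ![4, 1, 0, 5]
  have h3 := h ![0, 2, 3, 5] ![4, 1, 3, 5]
  have h4 := h ![0, 4, 2, 1] ![0, 4, 2, 1]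
  have h5 := h ![0, 3, 2, 1] ![4, 0, 2, 1]
  have h6 := h ![0, 3, 4, 2] ![4, 0, 3, 1]
  rw [det_fin_four] at h1 h2 h3 h4 h5 h6
  simp [fermatCat, hd] at h1 h2 h3 h4 h5 h6
  rcases h5 with rfl | h5
  · have ha : a = 0 := by simpa using h3
    have hb : b = 0 := by simpa using h1
    simp [ha, hb, hd] at h4
  · have h7 : a * c ^ 2 * d = 0 := by
      linear_combination -h6 + b * d * h5 - b * d * h3
    have h8 : a ^ 2 = d ^ 2 := by linear_combination h5 - h3
    have ha : a ≠ 0 := by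
      rintro rfl
      exact hd (by simpa using h8.symm)
    have hc : c = 0 := by simpa [ha, hd] using h7
    simp [hc, hd] at h5

theorem eq_zero_of_diag (h : MinorsVanish (fermatCat a b c 0 0 0)) : a = 0 := by
  have h1 := h ![1, 2, 4, 0] ![1, 2, 4, 0]
  have h2 := h ![2, 4, 0, 3] ![2, 4, 0, 3]
  have h3 := h ![1, 4, 0, 5] ![1, 4, 0, 5]
  have h4 := h ![4, 0, 3, 5] ![4, 0, 3, 5]
  rw [det_fin_four] at h1 h2 h3 h4
  simp [fermatCat] at h1 h2 h3 h4
  by_contra ha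
  have hbc : b = 0 ∧ c = 0 := by
    rcases h1 with rfl | rfl | h1
    · exact ⟨by simpa [ha] using h2, rfl⟩
    · exact ⟨rfl, by simpa [ha] using h3⟩
    · exact absurd h1 ha
  simp [hbc.1, hbc.2, ha] at h4

theorem eq_zero (h : MinorsVanish (fermatCat a b c d e f)) :
    a = 0 ∧ b = 0 ∧ c = 0 ∧ d = 0 ∧ e = 0 ∧ f = 0 := by
  have key : d = 0 ∧ e = 0 ∧ f = 0 := by
    have two {a b c d e f : ℂ} (h : MinorsVanish (fermatCat a b c d e f)) (hf : f = 0) :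
        d = 0 ∧ e = 0 ∧ f = 0 := by
      subst hf
      rcases mul_eq_zero.1 h.eq_zero_of_eq_zero with rfl | rfl
      · exact ⟨rfl, h.swap.middle_eq_zero, rfl⟩
      · exact ⟨h.middle_eq_zero, rfl, rfl⟩
    rcases mul_eq_zero.1 h.exists_eq_zero with h1 | hf
    · rcases mul_eq_zero.1 h1 with hd | he
      · obtain ⟨he, hf, hd⟩ := two h.rotate hd
        exact ⟨hd, he, hf⟩
      · obtain ⟨hf, hd, he⟩ := two h.rotate.rotate he
        exact ⟨hd, he, hf⟩
    · exact two h hf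
  obtain ⟨rfl, rfl, rfl⟩ := key
  exact ⟨h.eq_zero_of_diag, h.rotate.eq_zero_of_diag, h.rotate.rotate.eq_zero_of_diag, rfl, rfl,
    rfl⟩

end MinorsVanish

theorem coeff_pderiv_pow {n : ℕ} (i : Fin n) (k : ℕ) (f : MvPolynomial (Fin n) ℂ)
    (m : Fin n →₀ ℕ) :
    coeff m (((pderiv (R := ℂ) i).toLinearMap ^ k : Module.End ℂ (MvPolynomial (Fin n) ℂ)) f) =
      (m i + 1).ascFactorial k * coeff (m + Finsupp.single i k) f := by
  induction k generalizing f with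
  | zero => simp
  | succ k ih =>
    rw [pow_succ, Module.End.mul_apply, ih]
    simp only [Derivation.coeFn_coe, coeff_pderiv, Finsupp.add_apply, Finsupp.single_eq_same,
      Nat.ascFactorial_succ, add_assoc, ← Finsupp.single_add]
    push_cast
    ring

theorem coeff_prod_pderiv_pow {n : ℕ} (d : Fin n →₀ ℕ) (l : List (Fin n)) (hl : l.Nodup)
    (f : MvPolynomial (Fin n) ℂ) (m : Fin n →₀ ℕ) (hm : ∀ i ∈ l, m i = 0) :
    coeff m ((l.map fun i => ((pderiv (R := ℂ) i).toLinearMap ^ d i :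
        Module.End ℂ (MvPolynomial (Fin n) ℂ))).prod f) =
      (l.map fun i => ((d i).factorial : ℂ)).prod *
        coeff (m + (l.map fun i => Finsupp.single i (d i)).sum) f := by
  induction l generalizing m with
  | nil => simp
  | cons i l ih =>
    obtain ⟨hi, hl⟩ := List.nodup_cons.1 hl
    simp only [List.map_cons, List.prod_cons, List.sum_cons, Module.End.mul_apply]
    rw [coeff_pderiv_pow, ih hl, hm i (by simp), zero_add, Nat.one_ascFactorial, mul_assoc,
      add_assoc]
    intro j hj
    have : i ≠ j := fun h => hi (h ▸ hj)
    simp [hm j (by simp [hj]), this]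

theorem eval_zero_monOp {n : ℕ} (d : Fin n →₀ ℕ) (f : MvPolynomial (Fin n) ℂ) :
    eval (fun _ => (0 : ℂ)) (monOp d f) = (∏ i, ((d i).factorial : ℂ)) * coeff d f := by
  have h := coeff_prod_pderiv_pow d (List.finRange n) (List.nodup_finRange n) f 0 (by simp)
  rw [← List.ofFn_eq_map, ← List.ofFn_eq_map, ← List.ofFn_eq_map, List.prod_ofFn, List.sum_ofFn,
    zero_add, Finsupp.univ_sum_single] at h
  rw [monOp, ← h]
  simp [constantCoeff_eq]

theorem pairing_eq_sum {n : ℕ} (f k : MvPolynomial (Fin n) ℂ) {S : Finset (Fin n →₀ ℕ)}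
    (hS : k.support ⊆ S) :
    pairing f k = ∑ d ∈ S, coeff d k * ((∏ i, ((d i).factorial : ℂ)) * coeff d f) := by
  simp only [pairing, apolar, map_sum, smul_eval, eval_zero_monOp]
  refine Finset.sum_subset hS fun d _ hd => ?_
  rw [notMem_support_iff.1 hd, zero_mul]

/-- The apolarity pairing as a linear functional of its second argument. -/
noncomputable def pairingRight {n : ℕ} (f : MvPolynomial (Fin n) ℂ) :
    MvPolynomial (Fin n) ℂ →ₗ[ℂ] ℂ where
  toFun := pairing f
  map_add' p q := by
    classical
    rw [pairing_eq_sum f (p + q) support_add, pairing_eq_sum f p Finset.subset_union_left,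
      pairing_eq_sum f q Finset.subset_union_right, ← Finset.sum_add_distrib]
    exact Finset.sum_congr rfl fun d _ => by rw [coeff_add]; ring
  map_smul' c p := by
    rw [pairing_eq_sum f (c • p) support_smul, pairing_eq_sum f p subset_rfl, smul_eq_mul,
      Finset.mul_sum]
    exact Finset.sum_congr rfl fun d _ => by simp [coeff_smul]; ring

theorem pairingRight_apply {n : ℕ} (f k : MvPolynomial (Fin n) ℂ) :
    pairingRight f k = pairing f k :=
  rfl

theorem pairing_monomial {n : ℕ} (f : MvPolynomial (Fin n) ℂ) (d : Fin n →₀ ℕ) (c : ℂ) :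
    pairing f (monomial d c) = c * ((∏ i, ((d i).factorial : ℂ)) * coeff d f) := by
  rw [pairing_eq_sum f _ support_monomial_subset, Finset.sum_singleton, coeff_monomial, if_pos rfl]

theorem pairing_mul_X {n : ℕ} (f k : MvPolynomial (Fin n) ℂ) (i : Fin n) :
    pairing f (k * X i) = pairing (pderiv i f) k := by
  induction k using MvPolynomial.induction_on' with
  | monomial d c =>
    rw [X, monomial_mul, mul_one, pairing_monomial, pairing_monomial, coeff_pderiv]
    have : (∏ j, (((d + Finsupp.single i 1 : Fin n →₀ ℕ) j).factorial : ℂ)) =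
        (d i + 1) * ∏ j, ((d j).factorial : ℂ) := by
      rw [← Finset.mul_prod_erase _ _ (Finset.mem_univ i),
        ← Finset.mul_prod_erase (a := i) _ (fun j => ((d j).factorial : ℂ)) (Finset.mem_univ i),
        Finset.prod_congr rfl (g := fun j => ((d j).factorial : ℂ)) fun j hj => by
          simp [(Finset.ne_of_mem_erase hj).symm]]
      simp [Nat.factorial_succ, mul_assoc]
    rw [this]
    ring
  | add p q hp hq =>
    rw [add_mul, ← pairingRight_apply, map_add, pairingRight_apply, pairingRight_apply, hp, hq,
      ← pairingRight_apply, ← pairingRight_apply, ← map_add, pairingRight_apply]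

theorem pairing_mul_linForm {n : ℕ} (f k : MvPolynomial (Fin n) ℂ) (v : Fin n → ℂ) :
    pairing f (k * linForm v) = pairing (pdir v f) k := by
  have : pairing (pdir v f) k = ∑ i, v i * pairing (pderiv i f) k := by
    simp only [pairing_eq_sum _ k subset_rfl, pdir, coeff_sum, coeff_C_mul, Finset.mul_sum]
    rw [Finset.sum_comm]
    exact Finset.sum_congr rfl fun i _ => Finset.sum_congr rfl fun d _ => by ring
  rw [this, linForm, Finset.mul_sum, ← pairingRight_apply, map_sum]
  refine Finset.sum_congr rfl fun i _ => ?_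
  rw [mul_left_comm, C_mul', map_smul, pairingRight_apply, pairing_mul_X, smul_eq_mul]

/-- The linear form in the coefficients of `g` whose value is `pairing g k`. -/
noncomputable def pairingForm (k : MvPolynomial (Fin 3) ℂ) : MvPolynomial (Fin 3 →₀ ℕ) ℂ :=
  ∑ d ∈ k.support, C (coeff d k * ∏ i, ((d i).factorial : ℂ)) * X d

theorem eval_pairingForm (g k : MvPolynomial (Fin 3) ℂ) :
    eval (fun d => coeff d g) (pairingForm k) = pairing g k := by
  simp [pairingForm, pairing_eq_sum g k subset_rfl, mul_assoc]

/-- The catalecticant matrix of the quartic obtained by letting the conic with coordinates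
`v` act on a sextic, with both `v` and the coefficients of the sextic as variables. -/
noncomputable def genericCat :
    Matrix (Fin 6) (Fin 6) (MvPolynomial (Fin 6) (MvPolynomial (Fin 3 →₀ ℕ) ℂ)) :=
  Matrix.of fun j l => ∑ i, C (pairingForm (nuPoly j * nuPoly i * nuPoly l)) * X i

/-- The specialization of `genericCat` to the sextic `g` and the conic `v`. -/
noncomputable def sexticCat (g : MvPolynomial (Fin 3) ℂ) (v : Fin 6 → ℂ) :
    Matrix (Fin 6) (Fin 6) ℂ :=
  Matrix.of fun j l => ∑ i, pairing g (nuPoly j * nuPoly i * nuPoly l) * v i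

theorem genericCat_minor_isHomogeneous (r c : Fin 4 → Fin 6) :
    (genericCat.submatrix r c).det.IsHomogeneous 4 := by
  rw [Matrix.det_apply']
  refine IsHomogeneous.sum _ _ _ fun p _ => ?_
  have hentry (j l : Fin 6) : (genericCat j l).IsHomogeneous 1 := by
    rw [genericCat, Matrix.of_apply]
    exact IsHomogeneous.sum _ _ _ fun i _ => isHomogeneous_C_mul_X _ _
  have hprod := IsHomogeneous.prod Finset.univ
    (fun i => genericCat.submatrix r c (p i) i) (fun _ => 1) fun i _ => hentry _ _
  have := hprod.C_mul ((Equiv.Perm.sign p : ℤ) : MvPolynomial (Fin 3 →₀ ℕ) ℂ)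
  simpa using this

theorem eval_genericCat_minor (g : MvPolynomial (Fin 3) ℂ) (v : Fin 6 → ℂ) (r c : Fin 4 → Fin 6) :
    eval v (map (eval fun d => coeff d g) (genericCat.submatrix r c).det) =
      ((sexticCat g v).submatrix r c).det := by
  rw [RingHom.map_det, RingHom.map_det]
  congr 1
  ext i j
  simp [genericCat, sexticCat, eval_pairingForm]

theorem minorsVanish_of_ker {M : Matrix (Fin 6) (Fin 6) ℂ} {W : Submodule ℂ (Fin 6 → ℂ)}
    (hW : Module.finrank ℂ W = 3) (h : ∀ w ∈ W, M.mulVec w = 0) : MinorsVanish M := by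
  intro r c
  by_contra hdet
  have h1 : (M.submatrix r c).rank = 4 := by
    simpa using Matrix.rank_of_det_ne_zero hdet
  have h2 := M.rank_submatrix_le r c
  have h3 : W ≤ LinearMap.ker M.mulVecLin := fun w hw => h w hw
  have h4 := Submodule.finrank_mono h3
  have h5 := M.mulVecLin.finrank_range_add_finrank_ker
  rw [Module.finrank_fin_fun] at h5
  have h6 : M.rank = Module.finrank ℂ (LinearMap.range M.mulVecLin) := rfl
  omega

theorem sexticCat_mulVec_eq_zero {s : MvPolynomial (Fin 3) ℂ →ₗ[ℂ] MvPolynomial (Fin 6) ℂ}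
    (hs : IsSMap s) {g : MvPolynomial (Fin 3) ℂ} (hg : g.IsHomogeneous 6) {v w : Fin 6 → ℂ}
    (h : pdir v (pdir w (s g)) = 0) : (sexticCat g v).mulVec w = 0 := by
  ext j
  have hlin (u : Fin 6 → ℂ) : (linForm u).IsHomogeneous 1 :=
    IsHomogeneous.sum _ _ _ fun i _ => isHomogeneous_C_mul_X _ _
  have h1 := hs.2 g (X j * linForm v * linForm w) hg
    (((isHomogeneous_X ℂ j).mul (hlin v)).mul (hlin w))
  rw [pairing_mul_linForm, pairing_mul_linForm, h] at h1
  have h2 : pairing (0 : MvPolynomial (Fin 6) ℂ) (X j) = 0 := by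
    simp [pairing_eq_sum _ _ subset_rfl]
  have h3 : aeval nuPoly (X j * linForm v * linForm w) =
      ∑ l, ∑ i, (w l * v i) • (nuPoly j * nuPoly i * nuPoly l) := by
    simp only [linForm, map_mul, map_sum, aeval_X, aeval_C, Finset.mul_sum, Finset.sum_mul]
    refine Finset.sum_congr rfl fun l _ => Finset.sum_congr rfl fun i _ => ?_
    simp only [smul_eq_C_mul, algebraMap_eq, C_mul]
    ring
  rw [h2, h3, ← pairingRight_apply] at h1
  simp only [map_sum, map_smul, pairingRight_apply, smul_eq_mul] at h1
  simp only [Matrix.mulVec, dotProduct, sexticCat, Matrix.of_apply, Finset.sum_mul, Pi.zero_apply]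
  rw [h1]
  exact Finset.sum_congr rfl fun l _ => Finset.sum_congr rfl fun i _ => by ring

/-- The exponents of the components of the Veronese map. -/
def nuExp : Fin 6 → Fin 3 → ℕ :=
  ![![2, 0, 0], ![1, 1, 0], ![1, 0, 1], ![0, 2, 0], ![0, 1, 1], ![0, 0, 2]]

/-- The coefficients of the components of the Veronese map. -/
def nuScale : Fin 6 → ℂ := ![1, 2, 2, 1, 2, 1]

theorem nuPoly_eq_monomial (i : Fin 6) :
    nuPoly i = monomial (Finsupp.equivFunOnFinite.symm (nuExp i)) (nuScale i) := by
  rw [monomial_eq, Finsupp.prod_fintype _ _ (by simp)]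
  have h2 : (C 2 : MvPolynomial (Fin 3) ℂ) = 2 := map_ofNat C 2
  fin_cases i <;> simp [nuPoly, nuExp, nuScale, Fin.prod_univ_three, mul_assoc, h2]

/-- The exponents of the sextic `x⁶ + y⁶ + z⁶ + 90 x² y² z²`. -/
def fermatExp : Finset (Fin 3 → ℕ) := {![6, 0, 0], ![0, 6, 0], ![0, 0, 6], ![2, 2, 2]}

/-- The sextic `x⁶ + y⁶ + z⁶ + 90 x² y² z²`, a multiple of the sum of the divided power
monomials with exponents in `fermatExp`. -/
noncomputable def fermatSextic : MvPolynomial (Fin 3) ℂ :=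
  ∑ d ∈ fermatExp, monomial (Finsupp.equivFunOnFinite.symm d)
    (720 * (∏ i, ((d i).factorial : ℂ))⁻¹)

theorem fermatSextic_isHomogeneous : fermatSextic.IsHomogeneous 6 := by
  refine IsHomogeneous.sum _ _ _ fun d hd => isHomogeneous_monomial _ ?_
  rw [Finsupp.degree_eq_sum]
  have : ∀ d ∈ fermatExp, ∑ i, d i = 6 := by decide
  simpa using this d hd

theorem pairing_fermatSextic (d : Fin 3 → ℕ) (c : ℂ) :
    pairing fermatSextic (monomial (Finsupp.equivFunOnFinite.symm d) c) =
      if d ∈ fermatExp then 720 * c else 0 := by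
  have hne : (∏ i, ((d i).factorial : ℂ)) ≠ 0 :=
    Finset.prod_ne_zero_iff.2 fun i _ => Nat.cast_ne_zero.2 (Nat.factorial_ne_zero _)
  simp only [pairing_monomial, fermatSextic, coeff_sum, coeff_monomial,
    Finsupp.equivFunOnFinite.symm.injective.eq_iff, Finset.sum_ite_eq',
    Finsupp.coe_equivFunOnFinite_symm]
  split_ifs
  · field_simp
  · simp

theorem sexticCat_fermatSextic (v : Fin 6 → ℂ) (j l : Fin 6) :
    sexticCat fermatSextic v j l = nuScale j * (nuScale l *
      fermatCat (720 * v 0) (720 * v 3) (720 * v 5) (720 * (2 * v 4)) (720 * (2 * v 2))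
        (720 * (2 * v 1)) j l) := by
  have hpair (i : Fin 6) : pairing fermatSextic (nuPoly j * nuPoly i * nuPoly l) =
      if nuExp j + nuExp i + nuExp l ∈ fermatExp then
        720 * (nuScale j * nuScale i * nuScale l) else 0 := by
    rw [← pairing_fermatSextic]
    simp only [nuPoly_eq_monomial, monomial_mul]
    congr 3
    ext
    simp
  simp only [sexticCat, Matrix.of_apply, hpair, Fin.sum_univ_six]
  fin_cases j <;> fin_cases l <;>
    simp [fermatExp, nuExp, fermatCat, nuScale] <;> ring

theorem eq_zero_of_minorsVanish_fermatSextic {v : Fin 6 → ℂ}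
    (h : MinorsVanish (sexticCat fermatSextic v)) : v = 0 := by
  have hscale (i : Fin 6) : nuScale i ≠ 0 := by fin_cases i <;> simp [nuScale]
  have hM : MinorsVanish (fermatCat (720 * v 0) (720 * v 3) (720 * v 5) (720 * (2 * v 4))
      (720 * (2 * v 2)) (720 * (2 * v 1))) := by
    intro r c
    have h1 := h r c
    have h2 : (sexticCat fermatSextic v).submatrix r c = Matrix.of fun i j =>
        nuScale (r i) * (Matrix.of fun i j => nuScale (c j) *
          (fermatCat (720 * v 0) (720 * v 3) (720 * v 5) (720 * (2 * v 4))
            (720 * (2 * v 2)) (720 * (2 * v 1))).submatrix r c i j) i j := by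
      ext i j
      exact sexticCat_fermatSextic v (r i) (c j)
    rw [h2, Matrix.det_mul_column, Matrix.det_mul_row] at h1
    simpa [Finset.prod_eq_zero_iff, hscale] using h1
  obtain ⟨h0, h3, h5, h4, h2, h1⟩ := hM.eq_zero
  ext i
  fin_cases i <;> simp_all

/-- **Corollary 2.5.** A general cubic fourfold apolar to a Veronese surface has no net
of partial derivatives singular at a given point. -/
theorem statement8 :
    ∃ P : MvPolynomial ((Fin 3) →₀ ℕ) ℂ,
      (∃ g₀ : MvPolynomial (Fin 3) ℂ, g₀.IsHomogeneous 6 ∧ evalCoeff g₀ P ≠ 0) ∧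
      ∀ g : MvPolynomial (Fin 3) ℂ, g.IsHomogeneous 6 → evalCoeff g P ≠ 0 →
        ∀ s : MvPolynomial (Fin 3) ℂ →ₗ[ℂ] MvPolynomial (Fin 6) ℂ, IsSMap s →
          ¬ ∃ (v : Fin 6 → ℂ) (W : Submodule ℂ (Fin 6 → ℂ)), v ≠ 0 ∧
              Module.finrank ℂ W = 3 ∧ ∀ w ∈ W, pdir v (pdir w (s g)) = 0 := by
  obtain ⟨P, hP₀, hP⟩ := exists_eval_ne_zero_forall_common_zero_eq_zero
    (fun rc : (Fin 4 → Fin 6) × (Fin 4 → Fin 6) => (genericCat.submatrix rc.1 rc.2).det)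
    (fun rc => genericCat_minor_isHomogeneous rc.1 rc.2) (fun d => coeff d fermatSextic)
    (fun v hv => eq_zero_of_minorsVanish_fermatSextic fun r c => by
      rw [← eval_genericCat_minor]
      exact hv (r, c))
  refine ⟨P, ⟨fermatSextic, fermatSextic_isHomogeneous, hP₀⟩, ?_⟩
  rintro g hg hPg s hs ⟨v, W, hv, hW, h⟩
  have hM : MinorsVanish (sexticCat g v) :=
    minorsVanish_of_ker hW fun w hw => sexticCat_mulVec_eq_zero hs hg (h w hw)
  refine hv (hP _ hPg v fun rc => ?_)
  rw [eval_genericCat_minor]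
  exact hM rc.1 rc.2
end

section
/- Let f ∈ ℂ[x₀,…,x₅] be a cubic form and Q_f := {q a quadratic form in x₀,…,x₅ : q∘f = 0}. Suppose v, w ∈ ℂ⁶ are linearly independent and the two evaluation functionals q ↦ q(v) and q ↦ q(w) on Q_f are linearly dependent. Then f has a nonzero directional partial derivative of rank at most 2, i.e., there is u ∈ ℂ⁶ with ∂_u f ≠ 0 and rank(∂_u f) ≤ 2. (This is the claim, used throughout Section 3 of the paper, that the map q_f defined by the quadrics apolar to f is an embedding whenever f has no partial derivative of rank ≤ 2.) -/
open MvPolynomial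

theorem pderiv_commute {σ R : Type*} [CommRing R] (i j : σ) (p : MvPolynomial σ R) :
    pderiv i (pderiv j p) = pderiv j (pderiv i p) := by
  classical
  have h : ⁅pderiv (R := R) i, pderiv (R := R) j⁆ = 0 := by
    ext k : 1
    simp [Derivation.commutator_apply, pderiv_X, Pi.single_apply, apply_ite]
  rw [← sub_eq_zero, ← Derivation.commutator_apply, h, Derivation.zero_apply]

theorem List.prod_map_mul_of_commute {ι M : Type*} [Monoid M] (l : List ι) {f g : ι → M}
    (h : ∀ i j, Commute (f i) (g j)) :
    (l.map fun i => f i * g i).prod = (l.map f).prod * (l.map g).prod := by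
  induction l with
  | nil => simp
  | cons a l ih =>
    have hc : Commute (g a) (l.map f).prod := by
      refine Commute.list_prod_right _ _ fun x hx => ?_
      obtain ⟨i, -, rfl⟩ := List.mem_map.1 hx
      exact (h i a).symm
    simp only [List.map_cons, List.prod_cons, ih]
    rw [mul_assoc, ← mul_assoc (g a), hc.eq, mul_assoc, mul_assoc]

theorem monOp_add {n : ℕ} (d e : Fin n →₀ ℕ) : monOp (d + e) = monOp d * monOp e := by
  simp only [monOp, List.ofFn_eq_map, Finsupp.add_apply, pow_add]
  refine List.prod_map_mul_of_commute _ fun i j => Commute.pow_pow ?_ _ _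
  exact LinearMap.ext (pderiv_commute i j)

theorem monOp_single_one {n : ℕ} (i : Fin n) :
    monOp (Finsupp.single i 1) = (pderiv (R := ℂ) i).toLinearMap := by
  rw [monOp, List.ofFn_eq_map, List.prod_map_eq_pow_single i]
  · simp [List.count_eq_one_of_mem (List.nodup_finRange n) (List.mem_finRange i)]
  · intro j hj _
    simp [Finsupp.single_eq_of_ne hj]

/-- The apolarity action on a fixed polynomial `f`, as a linear map in the operator. -/
noncomputable def apolarLinear {n : ℕ} (f : MvPolynomial (Fin n) ℂ) :
    MvPolynomial (Fin n) ℂ →ₗ[ℂ] MvPolynomial (Fin n) ℂ :=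
  (basisMonomials (Fin n) ℂ).constr ℂ fun d => monOp d f

theorem apolarLinear_apply {n : ℕ} (g f : MvPolynomial (Fin n) ℂ) :
    apolarLinear f g = apolar g f := by
  rw [apolarLinear, Module.Basis.constr_apply]
  rfl

theorem apolarLinear_X_mul_X {n : ℕ} (f : MvPolynomial (Fin n) ℂ) (i j : Fin n) :
    apolarLinear f (X i * X j) = pderiv i (pderiv j f) := by
  have h : (X i * X j : MvPolynomial (Fin n) ℂ) =
      basisMonomials (Fin n) ℂ (Finsupp.single i 1 + Finsupp.single j 1) := by
    simp [X, monomial_mul]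
  rw [h, apolarLinear, Module.Basis.constr_basis, monOp_add, monOp_single_one, monOp_single_one]
  rfl

/-- The quadratic form `Σ Aᵢⱼ xᵢ xⱼ` of a coefficient array `A`. -/
noncomputable def quadForm {n : ℕ} (A : Fin n × Fin n → ℂ) : MvPolynomial (Fin n) ℂ :=
  ∑ p, A p • (X p.1 * X p.2)

theorem quadForm_isHomogeneous {n : ℕ} (A : Fin n × Fin n → ℂ) :
    (quadForm A).IsHomogeneous 2 :=
  (homogeneousSubmodule (Fin n) ℂ 2).sum_mem fun p _ =>
    (homogeneousSubmodule (Fin n) ℂ 2).smul_mem _ <|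
      (isHomogeneous_X ℂ p.1).mul (isHomogeneous_X ℂ p.2)

theorem eval_quadForm {n : ℕ} (A : Fin n × Fin n → ℂ) (x : Fin n → ℂ) :
    eval x (quadForm A) = ∑ p, A p * (x p.1 * x p.2) := by
  simp [quadForm, smul_eval]

theorem apolar_quadForm {n : ℕ} (A : Fin n × Fin n → ℂ) (f : MvPolynomial (Fin n) ℂ) :
    apolar (quadForm A) f = ∑ p, A p • pderiv p.1 (pderiv p.2 f) := by
  simp only [← apolarLinear_apply, quadForm, map_sum, map_smul, apolarLinear_X_mul_X]

/-- The third partial derivatives of `f` at the origin. -/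
noncomputable def thirdPartial {n : ℕ} (f : MvPolynomial (Fin n) ℂ) (i j k : Fin n) : ℂ :=
  coeff 0 (pderiv k (pderiv i (pderiv j f)))

theorem MvPolynomial.IsHomogeneous.eq_zero_of_pderiv_coeff {n : ℕ}
    {g : MvPolynomial (Fin n) ℂ} (hg : g.IsHomogeneous 1)
    (h : ∀ k, coeff 0 (pderiv k g) = 0) : g = 0 := by
  have hk (k) : pderiv k g = 0 := by
    have := hg.pderiv (i := k)
    rw [totalDegree_eq_zero_iff_eq_C.1 (Nat.le_zero.1 this.totalDegree_le), h, C_0]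
  simpa [hk] using hg.sum_X_mul_pderiv.symm

theorem apolar_quadForm_eq_zero {n : ℕ} {f : MvPolynomial (Fin n) ℂ} (hf : f.IsHomogeneous 3)
    {A : Fin n × Fin n → ℂ} (h : ∀ k, ∑ p, A p * thirdPartial f p.1 p.2 k = 0) :
    apolar (quadForm A) f = 0 := by
  rw [apolar_quadForm]
  refine IsHomogeneous.eq_zero_of_pderiv_coeff ?_ fun k => ?_
  · exact (homogeneousSubmodule (Fin n) ℂ 1).sum_mem fun p _ =>
      (homogeneousSubmodule (Fin n) ℂ 1).smul_mem _ hf.pderiv.pderiv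
  · simpa [thirdPartial, coeff_sum] using h k

theorem MvPolynomial.IsHomogeneous.two_mul_eval {n : ℕ} {g : MvPolynomial (Fin n) ℂ}
    (hg : g.IsHomogeneous 2) (x : Fin n → ℂ) :
    2 * eval x g = ∑ i, ∑ j, coeff 0 (pderiv j (pderiv i g)) * x i * x j := by
  have h₂ := congrArg (eval x) hg.sum_X_mul_pderiv
  simp only [map_sum, map_mul, eval_X, nsmul_eq_mul, Nat.cast_ofNat, map_ofNat] at h₂
  rw [← h₂]
  refine Finset.sum_congr rfl fun i _ => ?_
  have h₁ := congrArg (eval x) (hg.pderiv (i := i)).sum_X_mul_pderiv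
  simp only [map_sum, map_mul, eval_X, Nat.add_one_sub_one, one_smul] at h₁
  rw [← h₁, Finset.mul_sum]
  refine Finset.sum_congr rfl fun j _ => ?_
  have h₀ : (pderiv j (pderiv i g)).IsHomogeneous 0 := hg.pderiv.pderiv
  rw [totalDegree_eq_zero_iff_eq_C.1 (Nat.le_zero.1 h₀.totalDegree_le)]
  simp only [eval_C, coeff_C, if_true]
  ring

theorem pdir_isHomogeneous {n m : ℕ} {f : MvPolynomial (Fin n) ℂ} (hf : f.IsHomogeneous m)
    (u : Fin n → ℂ) : (pdir u f).IsHomogeneous (m - 1) := by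
  refine (homogeneousSubmodule (Fin n) ℂ (m - 1)).sum_mem fun i _ => ?_
  rw [C_mul']
  exact (homogeneousSubmodule (Fin n) ℂ (m - 1)).smul_mem _ hf.pderiv

theorem coeff_pderiv_pderiv_pdir {n : ℕ} (f : MvPolynomial (Fin n) ℂ) (u : Fin n → ℂ)
    (i j : Fin n) :
    coeff 0 (pderiv j (pderiv i (pdir u f))) = ∑ k, u k * thirdPartial f i j k := by
  simp only [pdir, thirdPartial, C_mul', map_sum, Derivation.map_smul, coeff_sum, coeff_smul,
    smul_eq_mul]
  refine Finset.sum_congr rfl fun k _ => ?_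
  rw [pderiv_commute k i, pderiv_commute k j, pderiv_commute j i]

/-- A functional `A ↦ Σ Aᵢⱼ Bᵢⱼ` vanishing on all quadrics apolar to `f` comes from a
partial derivative of `f`. -/
theorem exists_sum_thirdPartial_eq {n : ℕ} {f : MvPolynomial (Fin n) ℂ} (hf : f.IsHomogeneous 3)
    (B : Fin n × Fin n → ℂ)
    (hB : ∀ A, apolar (quadForm A) f = 0 → ∑ p, A p * B p = 0) :
    ∃ u : Fin n → ℂ, ∀ p, ∑ k, u k * thirdPartial f p.1 p.2 k = B p := by
  let L (C : Fin n × Fin n → ℂ) : (Fin n × Fin n → ℂ) →ₗ[ℂ] ℂ :=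
    ∑ p, C p • LinearMap.proj p
  have hL (C A) : L C A = ∑ p, A p * C p := by
    simp [L, LinearMap.sum_apply, mul_comm]
  have hmem : L B ∈ Submodule.span ℂ
      (Set.range fun k => L fun p => thirdPartial f p.1 p.2 k) := by
    refine mem_span_of_iInf_ker_le_ker fun A hA => ?_
    simp only [Submodule.mem_iInf, LinearMap.mem_ker, hL] at hA ⊢
    exact hB A (apolar_quadForm_eq_zero hf hA)
  obtain ⟨u, hu⟩ := (Submodule.mem_span_range_iff_exists_fun ℂ).1 hmem
  refine ⟨u, fun p => ?_⟩
  simpa [hL, LinearMap.sum_apply, Pi.single_apply] using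
    LinearMap.congr_fun hu (Pi.single p 1)

/-- If two independent points have linearly dependent evaluation functionals on `Q_f`,
then `f` has a nonzero partial derivative of rank at most 2 (i.e. the map `q_f` defined
by the quadrics apolar to `f` is an embedding when no partial has rank `≤ 2`). -/
theorem statement11 (f : MvPolynomial (Fin 6) ℂ) (hf : f.IsHomogeneous 3)
    (v w : Fin 6 → ℂ) (hvw : LinearIndependent ℂ ![v, w])
    (hdep : ∃ c₁ c₂ : ℂ, ¬ (c₁ = 0 ∧ c₂ = 0) ∧
      ∀ q : MvPolynomial (Fin 6) ℂ, q.IsHomogeneous 2 → apolar q f = 0 →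
        c₁ * eval v q + c₂ * eval w q = 0) :
    ∃ u : Fin 6 → ℂ, pdir u f ≠ 0 ∧ QuadRankLe (pdir u f) 2 := by
  obtain ⟨c₁, c₂, hc, hq⟩ := hdep
  obtain ⟨u, hu⟩ := exists_sum_thirdPartial_eq hf
    (fun p => c₁ * (v p.1 * v p.2) + c₂ * (w p.1 * w p.2)) fun A hA => by
      have := hq _ (quadForm_isHomogeneous A) hA
      rw [eval_quadForm, eval_quadForm, Finset.mul_sum, Finset.mul_sum,
        ← Finset.sum_add_distrib] at this
      rw [← this]
      exact Finset.sum_congr rfl fun p _ => by ring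
  have hcoeff (i j : Fin 6) : coeff 0 (pderiv j (pderiv i (pdir u f))) =
      c₁ * (v i * v j) + c₂ * (w i * w j) :=
    (coeff_pderiv_pderiv_pdir f u i j).trans (hu (i, j))
  refine ⟨u, fun h0 => hc ?_, ?_⟩
  · rw [LinearIndependent.pair_iff] at hvw
    have hz (j : Fin 6) : c₁ * v j = 0 ∧ c₂ * w j = 0 := by
      refine hvw _ _ (funext fun i => ?_)
      have := hcoeff i j
      simp only [h0, map_zero, coeff_zero] at this
      simp only [Pi.add_apply, Pi.smul_apply, smul_eq_mul, Pi.zero_apply, this]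
      ring
    exact hvw c₁ c₂ (funext fun j => by simp [(hz j).1, (hz j).2])
  · refine ⟨Matrix.of (fun i k => (![c₁ / 2 * v i, c₂ / 2 * w i] : Fin 2 → ℂ) k) *
      Matrix.of ![v, w], ?_, ?_, fun x => ?_⟩
    · ext i j
      simp [Matrix.mul_apply]
      ring
    · exact (Matrix.rank_mul_le_left _ _).trans (Matrix.rank_le_width _)
    · refine mul_left_cancel₀ (two_ne_zero (α := ℂ)) ?_
      rw [(pdir_isHomogeneous hf u).two_mul_eval, Finset.mul_sum]
      refine Finset.sum_congr rfl fun i _ => ?_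
      rw [Finset.mul_sum]
      refine Finset.sum_congr rfl fun j _ => ?_
      simp only [hcoeff, Matrix.mul_apply, Matrix.of_apply, Fin.sum_univ_two, Matrix.cons_val_zero,
        Matrix.cons_val_one]
      ring
end
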